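/- arXiv:0808.3518 — 2 statements merged into one kernel-verified Lean document; each statement's English description precedes it below -/
import Mathlib

section
/- Let X be a positive part of Λ with X ≠ Λ, let Γ be an archimedean totally ordered abelian group, and let φ : Λ → Γ be a group homomorphism. Then the following four conditions are equivalent: (1) X ⊆ Pos(φ); (2) X⁺ ⊆ Pos(φ); (3) Pos⁺(φ) ⊆ X⁺; (4) Pos⁺(φ) ⊆ X. -/
open scoped TensorProduct

variable (Λ : Type) [AddCommGroup Λ]

/-- A subset `X` of a lattice `Λ` is a *positive part* if `Λ = X ∪ (-X)`,
`X + X ⊆ X`, and `X ∩ (-X)` is a subgroup of `Λ`. -/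
def IsPositivePart (X : Set Λ) : Prop :=
  X ∪ (-X) = Set.univ ∧ (∀ a ∈ X, ∀ b ∈ X, a + b ∈ X) ∧
    ∃ H : AddSubgroup Λ, (H : Set Λ) = X ∩ (-X)

theorem statement2 [Module.Free ℤ Λ] [Module.Finite ℤ Λ] (X : Set Λ) (hX : IsPositivePart Λ X)
    (hXproper : X ≠ Set.univ) (Γ : Type) [AddCommGroup Γ] [LinearOrder Γ] [IsOrderedAddMonoid Γ] [Archimedean Γ]
    (φ : Λ →+ Γ) :
    List.TFAE [X ⊆ {l : Λ | 0 ≤ φ l},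
      X \ (-X) ⊆ {l : Λ | 0 ≤ φ l},
      {l : Λ | 0 < φ l} ⊆ X \ (-X),
      {l : Λ | 0 < φ l} ⊆ X] := by
  obtain ⟨hU, hadd, H, hH⟩ := hX
  have hHm : ∀ z, z ∈ H ↔ z ∈ X ∧ -z ∈ X := by
    intro z
    rw [← SetLike.mem_coe, hH]
    simp
  have hU' : ∀ z, z ∈ X ∨ -z ∈ X := by
    intro z
    have : z ∈ X ∪ (-X) := by rw [hU]; trivial
    simpa using this
  have h0 : (0 : Λ) ∈ X := by simpa using hU' 0
  tfae_have 1 → 2 := fun h z hz => h hz.1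
  tfae_have 2 → 1 := by
    intro h x hx
    by_cases hnx : -x ∈ X
    swap
    · exact h ⟨hx, by simpa using hnx⟩
    by_contra hneg
    have hneg' : φ x < 0 := by simpa using hneg
    obtain ⟨z, hz⟩ := (Set.ne_univ_iff_exists_notMem X).1 hXproper
    have hy : -z ∈ X := (hU' z).resolve_left hz
    have hxH : x ∈ H := (hHm x).2 ⟨hx, hnx⟩
    obtain ⟨n, hn⟩ := Archimedean.arch (φ (-z)) (y := -φ x) (by simpa using hneg')
    have hkH : (n + 1) • x ∈ H := H.nsmul_mem hxH _
    have hk := ((hHm _).1 hkH).1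
    have hs : -z + (n + 1) • x ∈ X := hadd _ hy _ hk
    have hs2 : -(-z + (n + 1) • x) ∉ X := by
      intro hc
      have h1 := H.sub_mem ((hHm _).2 ⟨hs, hc⟩) hkH
      rw [add_sub_cancel_right] at h1
      exact hz (by simpa using ((hHm _).1 h1).2)
    have h2 : 0 ≤ φ (-z + (n + 1) • x) := h ⟨hs, by simpa only [Set.mem_neg] using hs2⟩
    rw [map_add, map_nsmul, succ_nsmul, ← add_assoc] at h2
    rw [smul_neg] at hn
    have h3 : φ (-z) + n • φ x ≤ 0 := by
      have := add_le_add_left hn (n • φ x)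
      simpa using this
    exact absurd (h2.trans_lt (add_neg_of_nonpos_of_neg h3 hneg')) (lt_irrefl _)
  tfae_have 1 → 3 := by
    intro h l hl
    have hl' : 0 < φ l := hl
    have hn : -l ∉ X := by
      intro hc
      have h1 : 0 ≤ φ (-l) := h hc
      rw [map_neg, neg_nonneg] at h1
      exact absurd hl' (not_lt.2 h1)
    exact ⟨(hU' l).resolve_right hn, by simpa using hn⟩
  tfae_have 3 → 4 := fun h z hz => (h hz).1
  tfae_have 4 → 2 := by
    intro h x hx
    by_contra hneg
    have hneg' : φ x < 0 := by simpa using hneg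
    exact hx.2 (by simpa using h (show 0 < φ (-x) by simpa using hneg'))
  tfae_finish
end

section
/- Let φ be a nonzero linear form on V. Then i_φ̄ : Pos(Ker φ|_Λ) → Pos(Λ) is continuous and induces a homeomorphism from Pos(Ker φ|_Λ) onto its image π^{-1}(φ̄) (endowed with the subspace topology), the inverse homeomorphism being Y ↦ Y ∩ Ker φ|_Λ. -/
open scoped TensorProduct

variable (Λ : Type) [AddCommGroup Λ]

/-- `Pos(Λ)`, the set of positive parts of `Λ`. -/
def PosParts : Type := {X : Set Λ // IsPositivePart Λ X}

/-- `U(E) = {X ∈ Pos(Λ) | X ∩ E = ∅}`. -/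
def UU (E : Set Λ) : Set (PosParts Λ) := {X | X.val ∩ E = ∅}

/-- The topology on `Pos(Λ)`: a subset `U` is open iff for every `X ∈ U` there is a
finite set `E ⊆ Λ` with `X ∈ U(E)` and `U(E) ⊆ U`. -/
instance posTop : TopologicalSpace (PosParts Λ) where
  IsOpen U := ∀ X ∈ U, ∃ E : Finset Λ, X ∈ UU Λ (E : Set Λ) ∧ UU Λ (E : Set Λ) ⊆ U
  isOpen_univ := by
    intro X _
    exact ⟨∅, by simp [UU], fun _ _ => trivial⟩
  isOpen_inter := by
    rintro s t hs ht X ⟨hXs, hXt⟩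
    obtain ⟨E1, h1, h1'⟩ := hs X hXs
    obtain ⟨E2, h2, h2'⟩ := ht X hXt
    letI := Classical.decEq Λ
    refine ⟨E1 ∪ E2, ?_, ?_⟩
    · simp only [UU, Set.mem_setOf_eq, Finset.coe_union, Set.inter_union_distrib_left] at *
      rw [h1, h2, Set.union_empty]
    · intro Y hY
      simp only [UU, Set.mem_setOf_eq, Finset.coe_union, Set.inter_union_distrib_left,
        Set.union_empty_iff] at hY
      exact ⟨h1' hY.1, h2' hY.2⟩
  isOpen_sUnion := by
    intro S hS X hX
    obtain ⟨s, hs, hXs⟩ := hX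
    obtain ⟨E, hE, hE'⟩ := hS s hs X hXs
    exact ⟨E, hE, fun Y hY => ⟨s, hs, hE' hY⟩⟩

/-- The real vector space `V = ℝ ⊗_ℤ Λ` spanned by the lattice `Λ`. -/
abbrev RV : Type := ℝ ⊗[ℤ] Λ

/-- The canonical map `Λ → ℝ ⊗_ℤ Λ`, `λ ↦ 1 ⊗ λ`. -/
noncomputable def iota : Λ →ₗ[ℤ] RV Λ := TensorProduct.mk ℤ ℝ Λ 1

/-- `Pos(φ) = {λ ∈ Λ | φ(λ) ≥ 0}` for a linear form `φ` on `V = ℝ ⊗_ℤ Λ`. -/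
def PosSet (φ : Module.Dual ℝ (RV Λ)) : Set Λ := {l | 0 ≤ φ (iota Λ l)}

/-- `Pos⁺(φ) = {λ ∈ Λ | φ(λ) > 0}` for a linear form `φ` on `V = ℝ ⊗_ℤ Λ`. -/
def PosPlus (φ : Module.Dual ℝ (RV Λ)) : Set Λ := {l | 0 < φ (iota Λ l)}

/-- The weak topology on the dual space `V*` (`V` being finite dimensional, this is
its standard topology). -/
noncomputable instance dualTop : TopologicalSpace (Module.Dual ℝ (RV Λ)) :=
  ⨅ v : RV Λ, TopologicalSpace.induced (fun φ => φ v) inferInstance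

/-- Two linear forms on `V` are equivalent iff they differ by a strictly positive scalar. -/
def dualSetoid : Setoid (Module.Dual ℝ (RV Λ)) where
  r φ ψ := ∃ κ : ℝ, 0 < κ ∧ ψ = κ • φ
  iseqv := by
    constructor
    · exact fun φ => ⟨1, one_pos, (one_smul ℝ φ).symm⟩
    · rintro φ ψ ⟨κ, hκ, rfl⟩
      exact ⟨κ⁻¹, inv_pos.2 hκ, by rw [smul_smul, inv_mul_cancel₀ hκ.ne', one_smul]⟩
    · rintro φ ψ χ ⟨κ, hκ, rfl⟩ ⟨κ', hκ', rfl⟩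
      exact ⟨κ' * κ, mul_pos hκ' hκ, smul_smul κ' κ φ⟩

/-- `V*/ℝ_{>0}`, the quotient of the dual space by positive rescaling, endowed with
the quotient topology. -/
abbrev DualQuot : Type := Quotient (dualSetoid Λ)

/-- Characterization of the map `π : Pos(Λ) → V*/ℝ_{>0}` from the Hahn–Banach theorem
for positive parts: `π X` is the unique class `φ̄` with `X ⊆ Pos(φ)` (represented by a
nonzero form when `X ≠ Λ`, and `π(Λ) = 0̄`). -/
def IsPi (π : PosParts Λ → DualQuot Λ) : Prop :=
  ∀ X : PosParts Λ, ∃ φ : Module.Dual ℝ (RV Λ),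
    π X = Quotient.mk (dualSetoid Λ) φ ∧ X.val ⊆ PosSet Λ φ ∧ (X.val ≠ Set.univ → φ ≠ 0)

/-- The lattice `Ker φ|_Λ = Λ ∩ Ker φ`. -/
noncomputable def kerLat (φ : Module.Dual ℝ (RV Λ)) : AddSubgroup Λ :=
  AddMonoidHom.ker ((φ.toAddMonoidHom).comp (iota Λ).toAddMonoidHom)

/-- The underlying subset of `Λ` of `i_φ̄(X) = X ∪ Pos⁺(φ)`, for `X ⊆ Ker φ|_Λ`. -/
noncomputable def iSet (φ : Module.Dual ℝ (RV Λ)) (S : Set (kerLat Λ φ)) : Set Λ :=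
  (Subtype.val '' S) ∪ PosPlus Λ φ

theorem isPositivePart_preimage {A B : Type} [AddCommGroup A] [AddCommGroup B]
    (σ : A →+ B) {X : Set B} (hX : IsPositivePart B X) :
    IsPositivePart A (σ ⁻¹' X) := by
  obtain ⟨h1, h2, H, hH⟩ := hX
  refine ⟨?_, ?_, ?_⟩
  · ext x
    simp only [Set.mem_union, Set.mem_preimage, Set.mem_neg, map_neg, Set.mem_univ, iff_true]
    have hx : σ x ∈ X ∪ (-X) := h1 ▸ Set.mem_univ _
    rcases hx with h | h
    · exact Or.inl h
    · exact Or.inr (by simpa using h)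
  · intro a ha b hb
    simp only [Set.mem_preimage, map_add] at *
    exact h2 _ ha _ hb
  · refine ⟨H.comap σ, ?_⟩
    ext x
    have hmem : σ x ∈ H ↔ σ x ∈ X ∩ (-X) := by
      constructor
      · intro h; rw [← hH]; exact h
      · intro h; rw [← hH] at h; exact h
    constructor
    · intro h
      have h' : σ x ∈ X ∩ (-X) := hmem.1 h
      exact ⟨h'.1, by simpa [Set.mem_neg, Set.mem_preimage, map_neg] using h'.2⟩
    · rintro ⟨hx1, hx2⟩
      exact hmem.2 ⟨hx1, by simpa [Set.mem_neg, Set.mem_preimage, map_neg] using hx2⟩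

theorem isPositivePart_iSet (φ : Module.Dual ℝ (RV Λ))
    (X : PosParts ↥(kerLat Λ φ)) : IsPositivePart Λ (iSet Λ φ X.val) := by
  obtain ⟨S, hS1, hS2, HS, hHS⟩ := X
  have hker : ∀ k : ↥(kerLat Λ φ), φ (iota Λ (k : Λ)) = 0 := fun k => k.property
  refine ⟨?_, ?_, ?_⟩
  · ext l
    simp only [iSet, Set.mem_union, Set.mem_neg, Set.mem_image, PosPlus, Set.mem_setOf_eq,
      Set.mem_univ, iff_true, map_neg]
    rcases lt_trichotomy 0 (φ (iota Λ l)) with h | h | h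
    · exact Or.inl (Or.inr h)
    · have hlK : l ∈ kerLat Λ φ := by
        show φ (iota Λ l) = 0
        exact h.symm
      have : (⟨l, hlK⟩ : ↥(kerLat Λ φ)) ∈ S ∪ (-S) := hS1 ▸ Set.mem_univ _
      rcases this with hk | hk
      · exact Or.inl (Or.inl ⟨⟨l, hlK⟩, hk, rfl⟩)
      · refine Or.inr (Or.inl ⟨-⟨l, hlK⟩, hk, rfl⟩)
    · exact Or.inr (Or.inr (by simpa using h))
  · rintro a (⟨ka, hka, rfl⟩ | ha) b (⟨kb, hkb, rfl⟩ | hb)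
    · exact Or.inl ⟨ka + kb, hS2 ka hka kb hkb, rfl⟩
    · refine Or.inr ?_
      show 0 < φ (iota Λ (↑ka + b))
      rw [map_add, map_add, hker ka, zero_add]
      exact hb
    · refine Or.inr ?_
      show 0 < φ (iota Λ (a + ↑kb))
      rw [map_add, map_add, hker kb, add_zero]
      exact ha
    · refine Or.inr ?_
      show 0 < φ (iota Λ (a + b))
      rw [map_add, map_add]
      exact add_pos ha hb
  · refine ⟨HS.map (kerLat Λ φ).subtype, ?_⟩
    have hval : ∀ {l : Λ}, l ∈ Subtype.val '' S → φ (iota Λ l) = 0 := by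
      rintro l ⟨k, _, rfl⟩; exact hker k
    ext l
    simp only [AddSubgroup.coe_map, AddSubgroup.coe_subtype, Set.mem_image, SetLike.mem_coe,
      Set.mem_inter_iff, Set.mem_neg, iSet, Set.mem_union, PosPlus, Set.mem_setOf_eq, map_neg]
    constructor
    · rintro ⟨k, hk, rfl⟩
      have hk' : k ∈ S ∩ (-S) := by rw [← hHS]; exact hk
      constructor
      · exact Or.inl ⟨k, hk'.1, rfl⟩
      · exact Or.inl ⟨-k, hk'.2, rfl⟩
    · rintro ⟨h1 | h1, h2 | h2⟩
      · -- l ∈ val '' S and -l ∈ val '' S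
        obtain ⟨k, hk, rfl⟩ := h1
        obtain ⟨k', hk', hk'eq⟩ := h2
        have : k' = -k := by
          apply Subtype.ext
          rw [hk'eq]; simp
        refine ⟨k, ?_, rfl⟩
        have : -k ∈ S := this ▸ hk'
        have hmem : k ∈ S ∩ (-S) := ⟨hk, this⟩
        rw [← hHS] at hmem
        exact hmem
      · exfalso
        obtain ⟨k, _, rfl⟩ := h1
        rw [hker k] at h2
        simp at h2
      · exfalso
        obtain ⟨k', hk', hk'eq⟩ := h2
        have : φ (iota Λ (-l)) = 0 := by rw [← hk'eq]; exact hker k'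
        rw [map_neg, map_neg] at this
        rw [show φ (iota Λ l) = 0 by linarith] at h1
        exact lt_irrefl 0 h1
      · exact absurd (lt_trans h1 (by simpa using h2)) (lt_irrefl _)

/-- The map `i_φ̄ : Pos(Ker φ|_Λ) → Pos(Λ)`, `X ↦ X ∪ Pos⁺(φ)`. -/
noncomputable def iMap (φ : Module.Dual ℝ (RV Λ)) :
    PosParts ↥(kerLat Λ φ) → PosParts Λ :=
  fun X => ⟨iSet Λ φ X.val, isPositivePart_iSet Λ φ X⟩

/-- The map `Pos(Λ) → Pos(Ker φ|_Λ)`, `Y ↦ Y ∩ Ker φ|_Λ`. -/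
noncomputable def kerRestrict (φ : Module.Dual ℝ (RV Λ)) :
    PosParts Λ → PosParts ↥(kerLat Λ φ) :=
  fun Y => ⟨((kerLat Λ φ).subtype) ⁻¹' Y.val,
    isPositivePart_preimage ((kerLat Λ φ).subtype) Y.property⟩

theorem aux_ext {φ ψ : Module.Dual ℝ (RV Λ)} (h : ∀ l, φ (iota Λ l) = ψ (iota Λ l)) :
    φ = ψ := by
  apply LinearMap.ext
  intro v
  induction v using TensorProduct.induction_on with
  | zero => simp
  | tmul r l =>
    have e : (r ⊗ₜ[ℤ] l : RV Λ) = r • iota Λ l := by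
      show _ = r • ((1 : ℝ) ⊗ₜ[ℤ] l : RV Λ)
      rw [TensorProduct.smul_tmul', smul_eq_mul, mul_one]
    rw [e, map_smul, map_smul, h]
  | add x y hx hy => rw [map_add, map_add, hx, hy]

theorem aux_exists_pos {φ : Module.Dual ℝ (RV Λ)} (hφ : φ ≠ 0) :
    ∃ a : Λ, 0 < φ (iota Λ a) := by
  by_contra hcon
  push Not at hcon
  apply hφ
  apply aux_ext
  intro l
  have h1 := hcon l
  have h2 := hcon (-l)
  rw [map_neg, map_neg] at h2
  simp only [LinearMap.zero_apply]
  linarith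

theorem aux_le {φ ψ : Module.Dual ℝ (RV Λ)} (h : PosPlus Λ φ ⊆ PosSet Λ ψ)
    {a : Λ} (ha : 0 < φ (iota Λ a)) (l : Λ) :
    φ (iota Λ l) * ψ (iota Λ a) ≤ ψ (iota Λ l) * φ (iota Λ a) := by
  by_contra hcon
  push Not at hcon
  have hδ := sub_pos.2 hcon
  have hψa : 0 ≤ ψ (iota Λ a) := h ha
  obtain ⟨n, hn⟩ := exists_nat_gt ((ψ (iota Λ a) * φ (iota Λ a)) /
    (φ (iota Λ l) * ψ (iota Λ a) - ψ (iota Λ l) * φ (iota Λ a)))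
  rw [div_lt_iff₀ hδ] at hn
  obtain ⟨m, hm1, hm2⟩ : ∃ m : ℤ, 0 < m * φ (iota Λ a) + n * φ (iota Λ l) ∧
      m * φ (iota Λ a) + n * φ (iota Λ l) ≤ φ (iota Λ a) := by
    refine ⟨⌊-(n * φ (iota Λ l)) / φ (iota Λ a)⌋ + 1, ?_, ?_⟩
    · have := Int.lt_floor_add_one (-(n * φ (iota Λ l)) / φ (iota Λ a))
      rw [div_lt_iff₀ ha] at this
      push_cast
      linarith
    · have := Int.floor_le (-(n * φ (iota Λ l)) / φ (iota Λ a))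
      rw [le_div_iff₀ ha] at this
      push_cast
      linarith
  have key : ∀ χ : Module.Dual ℝ (RV Λ), χ (iota Λ (m • a + (n : ℤ) • l)) =
      m * χ (iota Λ a) + n * χ (iota Λ l) := by
    intro χ
    rw [map_add, map_add, map_zsmul, map_zsmul, map_zsmul, map_zsmul]
    simp
  have h3 : (m • a + (n : ℤ) • l) ∈ PosSet Λ ψ := h (by
    show 0 < φ (iota Λ (m • a + (n : ℤ) • l))
    rw [key]; exact hm1)
  have h4 : 0 ≤ m * ψ (iota Λ a) + n * ψ (iota Λ l) := by
    rw [← key]; exact h3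
  have h5 := mul_nonneg h4 ha.le
  have h6 := mul_le_mul_of_nonneg_left hm2 hψa
  linarith

theorem aux_class {φ ψ : Module.Dual ℝ (RV Λ)} (h : PosPlus Λ φ ⊆ PosSet Λ ψ)
    (hφ : φ ≠ 0) (hψ : ψ ≠ 0) : ∃ κ : ℝ, 0 < κ ∧ ψ = κ • φ := by
  obtain ⟨a, ha⟩ := aux_exists_pos Λ hφ
  have hψa : 0 ≤ ψ (iota Λ a) := h ha
  have e : ψ = (ψ (iota Λ a) / φ (iota Λ a)) • φ := by
    apply aux_ext
    intro l
    have h1 := aux_le Λ h ha l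
    have h2 := aux_le Λ h ha (-l)
    simp only [map_neg] at h2
    rw [LinearMap.smul_apply, smul_eq_mul, div_mul_eq_mul_div, eq_div_iff ha.ne']
    linarith
  refine ⟨_, lt_of_le_of_ne (div_nonneg hψa ha.le) ?_, e⟩
  intro h0
  rw [← h0, zero_smul] at e
  exact hψ e

theorem aux_restrict_iMap (φ : Module.Dual ℝ (RV Λ)) (X : PosParts ↥(kerLat Λ φ)) :
    kerRestrict Λ φ (iMap Λ φ X) = X := by
  apply Subtype.ext
  ext k
  have hk : φ (iota Λ (k : Λ)) = 0 := k.property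
  show (k : Λ) ∈ iSet Λ φ X.val ↔ k ∈ X.val
  constructor
  · rintro (⟨k', hk', e⟩ | h)
    · rwa [← Subtype.ext e]
    · exact absurd hk (ne_of_gt h)
  · exact fun h => Or.inl ⟨k, h, rfl⟩

theorem aux_iMap_restrict (φ : Module.Dual ℝ (RV Λ)) (Y : PosParts Λ)
    (h : Y.val ⊆ PosSet Λ φ) : iMap Λ φ (kerRestrict Λ φ Y) = Y := by
  apply Subtype.ext
  ext l
  show l ∈ iSet Λ φ ((kerLat Λ φ).subtype ⁻¹' Y.val) ↔ l ∈ Y.val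
  constructor
  · rintro (⟨k, hk, rfl⟩ | hl)
    · exact hk
    · have : l ∈ Y.val ∪ (-Y.val) := Y.property.1 ▸ Set.mem_univ _
      rcases this with h1 | h1
      · exact h1
      · have h2 : 0 ≤ φ (iota Λ (-l)) := h h1
        have h3 : 0 < φ (iota Λ l) := hl
        rw [map_neg, map_neg] at h2
        linarith
  · intro hl
    have h1 : 0 ≤ φ (iota Λ l) := h hl
    rcases h1.lt_or_eq with h2 | h2
    · exact Or.inr h2
    · exact Or.inl ⟨⟨l, h2.symm⟩, hl, rfl⟩

theorem aux_continuous_iMap (φ : Module.Dual ℝ (RV Λ)) : Continuous (iMap Λ φ) := by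
  refine ⟨fun U hU X hX => ?_⟩
  obtain ⟨E, hE, hEU⟩ := hU _ hX
  have hfin : (Subtype.val ⁻¹' (E : Set Λ) : Set ↥(kerLat Λ φ)).Finite :=
    E.finite_toSet.preimage Subtype.val_injective.injOn
  have hE' : ∀ l, l ∈ iSet Λ φ X.val → l ∉ E := fun l hl hlE =>
    (Set.eq_empty_iff_forall_notMem.1 hE) l ⟨hl, hlE⟩
  refine ⟨hfin.toFinset, ?_, ?_⟩
  · refine Set.eq_empty_iff_forall_notMem.2 ?_
    rintro k ⟨hk, hkE⟩
    rw [hfin.coe_toFinset] at hkE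
    exact hE' k (Or.inl ⟨k, hk, rfl⟩) hkE
  · intro X' hX'
    apply hEU
    refine Set.eq_empty_iff_forall_notMem.2 ?_
    rintro l ⟨⟨k, hk, rfl⟩ | hl, hlE⟩
    · refine (Set.eq_empty_iff_forall_notMem.1 hX') k ⟨hk, ?_⟩
      rw [hfin.coe_toFinset]
      exact hlE
    · exact hE' l (Or.inr hl) hlE

theorem aux_continuous_restrict (φ : Module.Dual ℝ (RV Λ)) :
    Continuous (kerRestrict Λ φ) := by
  refine ⟨fun U hU Y hY => ?_⟩
  obtain ⟨E, hE, hEU⟩ := hU _ hY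
  refine ⟨E.map ⟨Subtype.val, Subtype.val_injective⟩, ?_, ?_⟩
  · refine Set.eq_empty_iff_forall_notMem.2 ?_
    rintro l ⟨hl, hlE⟩
    rw [Finset.coe_map] at hlE
    obtain ⟨k, hk, rfl⟩ := hlE
    exact (Set.eq_empty_iff_forall_notMem.1 hE) k ⟨hl, hk⟩
  · intro Y' hY'
    apply hEU
    refine Set.eq_empty_iff_forall_notMem.2 ?_
    rintro k ⟨hk, hkE⟩
    refine (Set.eq_empty_iff_forall_notMem.1 hY') k ⟨hk, ?_⟩
    rw [Finset.coe_map]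
    exact ⟨k, hkE, rfl⟩

theorem statement17 [Module.Free ℤ Λ] [Module.Finite ℤ Λ] (φ : Module.Dual ℝ (RV Λ)) (hφ : φ ≠ 0)
    (π : PosParts Λ → DualQuot Λ) (hπ : IsPi Λ π) :
    Continuous (iMap Λ φ) ∧
    Set.range (iMap Λ φ) = π ⁻¹' {Quotient.mk (dualSetoid Λ) φ} ∧
    (∀ X : PosParts ↥(kerLat Λ φ), kerRestrict Λ φ (iMap Λ φ X) = X) ∧
    (∀ Y : PosParts Λ, π Y = Quotient.mk (dualSetoid Λ) φ →
      iMap Λ φ (kerRestrict Λ φ Y) = Y) ∧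
    Continuous (fun Y : (π ⁻¹' {Quotient.mk (dualSetoid Λ) φ} : Set (PosParts Λ)) =>
      kerRestrict Λ φ Y.val) := by
  have h4 : ∀ Y : PosParts Λ, π Y = Quotient.mk (dualSetoid Λ) φ →
      iMap Λ φ (kerRestrict Λ φ Y) = Y := by
    intro Y hY
    obtain ⟨ψ, h1, h2, -⟩ := hπ Y
    obtain ⟨κ, hκ, e⟩ : ∃ κ : ℝ, 0 < κ ∧ ψ = κ • φ := Quotient.exact (hY.symm.trans h1)
    apply aux_iMap_restrict
    intro l hl
    have h3 : 0 ≤ ψ (iota Λ l) := h2 hl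
    rw [e, LinearMap.smul_apply, smul_eq_mul] at h3
    exact nonneg_of_mul_nonneg_right h3 hκ
  refine ⟨aux_continuous_iMap Λ φ, ?_, aux_restrict_iMap Λ φ, h4,
    (aux_continuous_restrict Λ φ).comp continuous_subtype_val⟩
  apply Set.Subset.antisymm
  · rintro _ ⟨X, rfl⟩
    obtain ⟨ψ, h1, h2, h3⟩ := hπ (iMap Λ φ X)
    have hne : (iMap Λ φ X).val ≠ Set.univ := by
      intro hu
      obtain ⟨a, ha⟩ := aux_exists_pos Λ hφ
      have hm : -a ∈ iSet Λ φ X.val := by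
        have : -a ∈ (iMap Λ φ X).val := hu ▸ Set.mem_univ _
        exact this
      rcases hm with ⟨k, _, e⟩ | hm
      · have hk : φ (iota Λ (k : Λ)) = 0 := k.property
        rw [e, map_neg, map_neg] at hk
        linarith
      · have hm' : 0 < φ (iota Λ (-a)) := hm
        rw [map_neg, map_neg] at hm'
        linarith
    have := aux_class Λ (fun l hl => h2 (Or.inr hl)) hφ (h3 hne)
    show π _ = _
    rw [h1]
    exact (Quotient.sound (s := dualSetoid Λ) this).symm
  · intro Y hY
    exact ⟨_, h4 Y hY⟩
end
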